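/- (Binomial moments) Let 𝒞 ⊆ 𝕄 be a code. Then for every v ∈ ℤ_{≥0}^{ℓ}: Σ_{u ∈ ℤ_{≥0}^{ℓ}} W_u(𝒞) Π_{i=1}^{ℓ} [n_i − u_i choose v_i − u_i]_q = (|𝒞| / q^{Σ_{i=1}^{ℓ} m_i (n_i − v_i)}) · Σ_{u ∈ ℤ_{≥0}^{ℓ}} W_u(𝒞^⊥) Π_{i=1}^{ℓ} [n_i − u_i choose v_i]_q. -/

import Mathlib

open Matrix Finset

section SumRank

variable {F : Type*} [Field F] [Fintype F] {ℓ : ℕ} {m n : Fin ℓ → ℕ}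

/-- The sum-rank weight of a tuple of matrices. -/
noncomputable def srk (C : ∀ i : Fin ℓ, Matrix (Fin (m i)) (Fin (n i)) F) : ℕ :=
  ∑ i, (C i).rank

/-- The weighted sum `∑ m i * rank (C i)`. -/
noncomputable def wsum (C : ∀ i : Fin ℓ, Matrix (Fin (m i)) (Fin (n i)) F) : ℕ :=
  ∑ i, m i * (C i).rank

/-- The minimum sum-rank distance of a code. -/
noncomputable def dmin (𝒞 : Submodule F (∀ i : Fin ℓ, Matrix (Fin (m i)) (Fin (n i)) F)) : ℕ :=
  sInf {w | ∃ C ∈ 𝒞, C ≠ 0 ∧ srk C = w}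

/-- The maximum sum-rank weight of a code. -/
noncomputable def maxsrk (𝒞 : Submodule F (∀ i : Fin ℓ, Matrix (Fin (m i)) (Fin (n i)) F)) : ℕ :=
  sSup {w | ∃ C ∈ 𝒞, srk C = w}

/-- An optimal rank-metric anticode in `F^(m×n)`. -/
def IsOptRkAnticode {m n : ℕ} (A : Submodule F (Matrix (Fin m) (Fin n) F)) : Prop :=
  Module.finrank F A = m * sSup {r | ∃ M ∈ A, (M : Matrix (Fin m) (Fin n) F).rank = r}

/-- An optimal sum-rank-metric anticode. -/
def IsOptAnticode (𝒞 : Submodule F (∀ i : Fin ℓ, Matrix (Fin (m i)) (Fin (n i)) F)) : Prop :=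
  Module.finrank F 𝒞 = sSup {w | ∃ C ∈ 𝒞, wsum C = w}

/-- The weight of a code. -/
noncomputable def wtCode (𝒞 : Submodule F (∀ i : Fin ℓ, Matrix (Fin (m i)) (Fin (n i)) F)) : ℕ :=
  sInf {w | ∃ A : ∀ i : Fin ℓ, Submodule F (Matrix (Fin (m i)) (Fin (n i)) F),
    (∀ i, IsOptRkAnticode (A i)) ∧ 𝒞 ≤ Submodule.pi Set.univ A ∧
    w = maxsrk (Submodule.pi Set.univ A)}

/-- The `r`-th generalized sum-rank weight of a code. -/
noncomputable def genWt (𝒞 : Submodule F (∀ i : Fin ℓ, Matrix (Fin (m i)) (Fin (n i)) F))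
    (r : ℕ) : ℕ :=
  sInf {w | ∃ 𝒟 : Submodule F (∀ i : Fin ℓ, Matrix (Fin (m i)) (Fin (n i)) F),
    𝒟 ≤ 𝒞 ∧ r ≤ Module.finrank F 𝒟 ∧ w = wtCode 𝒟}

/-- The trace-dual of a code. -/
def dualCode (𝒞 : Submodule F (∀ i : Fin ℓ, Matrix (Fin (m i)) (Fin (n i)) F)) :
    Submodule F (∀ i : Fin ℓ, Matrix (Fin (m i)) (Fin (n i)) F) where
  carrier := {D | ∀ C ∈ 𝒞, ∑ i, Matrix.trace (D i * (C i)ᵀ) = 0}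
  add_mem' := by
    intro a b ha hb C hC
    have h1 := ha C hC
    have h2 := hb C hC
    simp only [Pi.add_apply, Matrix.add_mul, Matrix.trace_add, Finset.sum_add_distrib,
      Set.mem_setOf_eq] at *
    rw [h1, h2, add_zero]
  zero_mem' := by
    intro C hC
    simp
  smul_mem' := by
    intro r a ha C hC
    have h1 := ha C hC
    simp only [Pi.smul_apply, Matrix.smul_mul, Matrix.trace_smul, ← Finset.smul_sum,
      Set.mem_setOf_eq] at *
    rw [h1, smul_zero]

/-- The MSRD property. -/
def IsMSRD (𝒞 : Submodule F (∀ i : Fin ℓ, Matrix (Fin (m i)) (Fin (n i)) F)) : Prop :=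
  ∃ (j : Fin ℓ) (δ : ℕ), δ ≤ n j - 1 ∧
    dmin 𝒞 = ∑ i ∈ Finset.Iio j, n i + δ + 1 ∧
    Module.finrank F 𝒞 = ∑ i ∈ Finset.Ici j, m i * n i - δ * m j

end SumRank

/-- The `q`-ary Gaussian binomial coefficient `[a choose b]_q` for integers `a b`. -/
noncomputable def gauss (q : ℚ) (a b : ℤ) : ℚ :=
  if a < 0 ∨ b < 0 ∨ a < b then 0
  else if b = 0 then 1
  else (∏ i ∈ Finset.range b.toNat, (q ^ (a - i).toNat - 1)) /
       (∏ i ∈ Finset.range b.toNat, (q ^ (i + 1) - 1))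

/-- The rank-list distribution `W_u(𝒞)`: the number of codewords whose `i`-th block has rank
`u i` for all `i`. -/
noncomputable def Wlist {F : Type*} [Field F] [Fintype F] {ℓ : ℕ} {m n : Fin ℓ → ℕ}
    (𝒞 : Submodule F (∀ i : Fin ℓ, Matrix (Fin (m i)) (Fin (n i)) F)) (u : Fin ℓ → ℕ) : ℕ :=
  Nat.card {C : ∀ i : Fin ℓ, Matrix (Fin (m i)) (Fin (n i)) F //
    C ∈ 𝒞 ∧ ∀ i, (C i).rank = u i}


/-! ### Gaussian coefficients -/

/-- q-factorial. -/
noncomputable def qfac (q : ℚ) (a : ℕ) : ℚ := ∏ i ∈ Finset.range a, (q ^ (i + 1) - 1)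

theorem qfac_ne_zero {q : ℚ} (hq : 1 < q) (a : ℕ) : qfac q a ≠ 0 := by
  refine Finset.prod_ne_zero_iff.2 fun i _ => ?_
  have := one_lt_pow₀ hq (Nat.succ_ne_zero i)
  exact sub_ne_zero.2 this.ne'

theorem prod_falling (q : ℚ) (a b : ℕ) (h : b ≤ a) :
    (∏ i ∈ Finset.range b, (q ^ (a - i) - 1)) * qfac q (a - b) = qfac q a := by
  induction b with
  | zero => simp
  | succ b ih =>
    rw [← ih (by omega), Finset.prod_range_succ, mul_assoc]
    congr 1
    obtain ⟨c, rfl⟩ := Nat.exists_eq_add_of_le h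
    have h1 : b + 1 + c - b = c + 1 := by omega
    have h2 : b + 1 + c - (b + 1) = c := by omega
    rw [h1, h2]
    simp only [qfac, Finset.prod_range_succ]
    ring

theorem gauss_eq {q : ℚ} (hq : 1 < q) (a b : ℕ) (h : b ≤ a) :
    gauss q a b = qfac q a / (qfac q (a - b) * qfac q b) := by
  have h0 := qfac_ne_zero hq
  have key : gauss q a b = (∏ i ∈ Finset.range b, (q ^ (a - i) - 1)) / qfac q b := by
    unfold gauss
    rw [if_neg (by omega)]
    split_ifs with hb
    · have : b = 0 := by exact_mod_cast hb
      subst this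
      simp [qfac]
    · simp only [Int.toNat_natCast, qfac]
      congr 1
      refine Finset.prod_congr rfl fun i _ => ?_
      congr 2
      omega
  rw [key, ← prod_falling q a b h]
  have := h0 (a - b)
  have := h0 b
  field_simp

theorem gauss_zero_of_lt (q : ℚ) (a b : ℤ) (h : a < b) : gauss q a b = 0 := by
  unfold gauss
  rw [if_pos (by omega)]

theorem gauss_symm {q : ℚ} (hq : 1 < q) (n r v : ℕ) (hr : r ≤ n) (hv : v ≤ n) :
    gauss q ((n : ℤ) - r) ((v : ℤ) - r) = gauss q ((n - r : ℕ) : ℤ) ((n - v : ℕ) : ℤ) := by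
  by_cases h : r ≤ v
  · have e1 : (n : ℤ) - r = ((n - r : ℕ) : ℤ) := by omega
    have e2 : (v : ℤ) - r = ((v - r : ℕ) : ℤ) := by omega
    rw [e1, e2, gauss_eq hq _ _ (by omega), gauss_eq hq _ _ (by omega), mul_comm (qfac q _)]
    congr 3 <;> omega
  · rw [gauss_zero_of_lt _ ((n - r : ℕ) : ℤ) _ (by omega)]
    unfold gauss
    rw [if_pos (by omega)]

theorem prod_linInd {q : ℚ} (a b : ℕ) (h : b ≤ a) :
    ∏ i ∈ Finset.range b, (q ^ a - q ^ i) =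
      (∏ i ∈ Finset.range b, q ^ i) * ∏ i ∈ Finset.range b, (q ^ (a - i) - 1) := by
  rw [← Finset.prod_mul_distrib]
  refine Finset.prod_congr rfl fun i hi => ?_
  have : i < b := Finset.mem_range.1 hi
  rw [mul_sub, ← pow_add]
  rw [mul_one, Nat.add_sub_of_le (by omega)]

/-! ### Counting subspaces -/

section CountSub

variable {F : Type*} [Field F] [Fintype F] {V : Type*} [AddCommGroup V] [Module F V] [Finite V]

theorem card_li_in (W : Submodule F V) (k : ℕ) (hk : k ≤ Module.finrank F W) :
    (Nat.card {s : Fin k → V // LinearIndependent F s ∧ ∀ j, s j ∈ W} : ℚ) =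
      (∏ i ∈ Finset.range k, (Fintype.card F : ℚ) ^ i) *
        ∏ i ∈ Finset.range k, ((Fintype.card F : ℚ) ^ (Module.finrank F W - i) - 1) := by
  have e : {s : Fin k → V // LinearIndependent F s ∧ ∀ j, s j ∈ W} ≃
      {s : Fin k → W // LinearIndependent F s} :=
    { toFun := fun s => ⟨fun j => ⟨s.1 j, s.2.2 j⟩, by
        have := s.2.1
        exact LinearIndependent.of_comp W.subtype this⟩
      invFun := fun s => ⟨fun j => (s.1 j : V), by
        exact s.2.map' W.subtype (Submodule.ker_subtype W), fun j => (s.1 j).2⟩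
      left_inv := fun s => rfl
      right_inv := fun s => rfl }
  rw [Nat.card_congr e]
  have : Fintype W := Fintype.ofFinite W
  rw [card_linearIndependent hk, ← prod_linInd _ _ hk,
    ← Fin.prod_univ_eq_prod_range (fun i => ((Fintype.card F : ℚ) ^ _ - (Fintype.card F : ℚ) ^ i))]
  push_cast
  refine Finset.prod_congr rfl fun i _ => ?_
  rw [Nat.cast_sub]
  · push_cast; rfl
  · exact Nat.pow_le_pow_right Fintype.card_pos (by omega)

theorem card_sub_mul (W : Submodule F V) (k : ℕ) :
    Nat.card {s : Fin k → V // LinearIndependent F s ∧ ∀ j, s j ∈ W} =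
     ∑ᶠ U : {U : Submodule F V // U ≤ W ∧ Module.finrank F U = k}, 
       Nat.card {s : Fin k → V // LinearIndependent F s ∧ ∀ j, s j ∈ U.1} := by
  classical
  have : Fintype {U : Submodule F V // U ≤ W ∧ Module.finrank F U = k} := Fintype.ofFinite _
  rw [finsum_eq_sum_of_fintype, ← Nat.card_sigma]
  refine Nat.card_congr
    { toFun := fun s => ⟨⟨Submodule.span F (Set.range s.1), ?_, ?_⟩, ⟨s.1, s.2.1, ?_⟩⟩
      invFun := fun s => ⟨s.2.1, s.2.2.1, fun j => s.1.2.1 (s.2.2.2 j)⟩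
      left_inv := fun s => rfl
      right_inv := ?_ }
  · rw [Submodule.span_le]
    rintro _ ⟨j, rfl⟩
    exact s.2.2 j
  · rw [finrank_span_eq_card s.2.1, Fintype.card_fin]
  · exact fun j => Submodule.subset_span ⟨j, rfl⟩
  · rintro ⟨⟨U, hU, hk⟩, ⟨s, hs, hsU⟩⟩
    have : Submodule.span F (Set.range s) = U := by
      apply Submodule.eq_of_le_of_finrank_eq
      · rw [Submodule.span_le]
        rintro _ ⟨j, rfl⟩
        exact hsU j
      · rw [finrank_span_eq_card hs, Fintype.card_fin, hk]
    subst this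
    rfl

theorem card_sub (W : Submodule F V) (k : ℕ) :
    (Nat.card {U : Submodule F V // U ≤ W ∧ Module.finrank F U = k} : ℚ) =
      gauss (Fintype.card F) (Module.finrank F W) k := by
  classical
  have hq : (1 : ℚ) < Fintype.card F := by exact_mod_cast Fintype.one_lt_card
  by_cases hk : k ≤ Module.finrank F W
  · have : Fintype {U : Submodule F V // U ≤ W ∧ Module.finrank F U = k} := Fintype.ofFinite _
    have h := congrArg (Nat.cast : ℕ → ℚ) (card_sub_mul W k)
    rw [finsum_eq_sum_of_fintype] at h
    push_cast at h
    rw [card_li_in W k hk] at h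
    have h2 : ∀ U : {U : Submodule F V // U ≤ W ∧ Module.finrank F U = k},
        (Nat.card {s : Fin k → V // LinearIndependent F s ∧ ∀ j, s j ∈ U.1} : ℚ) =
        (∏ i ∈ Finset.range k, (Fintype.card F : ℚ) ^ i) * qfac (Fintype.card F) k := by
      intro U
      rw [card_li_in U.1 k U.2.2.ge, U.2.2]
      have := prod_falling (Fintype.card F : ℚ) k k le_rfl
      rw [← this]
      simp [qfac]
    rw [Finset.sum_congr rfl fun U _ => h2 U, Finset.sum_const, nsmul_eq_mul, Finset.card_univ] at h
    rw [Nat.card_eq_fintype_card, gauss_eq hq _ _ hk, ← prod_falling _ _ _ hk]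
    have hP : (∏ i ∈ Finset.range k, (Fintype.card F : ℚ) ^ i) ≠ 0 :=
      Finset.prod_ne_zero_iff.2 fun i _ => pow_ne_zero _ (by linarith)
    have h3 := qfac_ne_zero hq k
    have h4 := qfac_ne_zero hq (Module.finrank F W - k)
    rw [eq_div_iff (mul_ne_zero h4 h3)]
    apply mul_left_cancel₀ hP
    linear_combination (-qfac (Fintype.card F) (Module.finrank F W - k)) * h
  · rw [gauss_zero_of_lt _ _ _ (by omega)]
    have : IsEmpty {U : Submodule F V // U ≤ W ∧ Module.finrank F U = k} :=
      ⟨fun U => hk (U.2.2 ▸ Submodule.finrank_mono U.2.1)⟩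
    simp

end CountSub

/-! ### Duality -/

section Duality

variable {F : Type*} [Field F]

/-- The dot product as a bilinear form. -/
def dotB (F : Type*) [Field F] (n : ℕ) : LinearMap.BilinForm F (Fin n → F) :=
  LinearMap.mk₂ F (fun x y => x ⬝ᵥ y) (fun x y z => add_dotProduct x y z)
    (fun c x y => smul_dotProduct c x y) (fun x y z => dotProduct_add x y z)
    (fun c x y => dotProduct_smul c x y)

theorem dotB_apply (n : ℕ) (x y : Fin n → F) : dotB F n x y = x ⬝ᵥ y := rfl

theorem dotB_refl (n : ℕ) : (dotB F n).IsRefl := by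
  intro x y h
  rw [dotB_apply] at *
  rw [dotProduct_comm, h]

theorem dotB_nondeg (n : ℕ) : (dotB F n).Nondegenerate := by
  have hr : LinearMap.IsRefl (dotB F n) := dotB_refl n
  refine hr.nondegenerate_iff_separatingLeft.2 ?_
  intro x hx
  exact dotProduct_eq_zero x hx

/-- Orthogonal subspace for the dot product. -/
def perp {n : ℕ} (K : Submodule F (Fin n → F)) : Submodule F (Fin n → F) :=
  (dotB F n).orthogonal K

theorem mem_perp {n : ℕ} {K : Submodule F (Fin n → F)} {x : Fin n → F} :
    x ∈ perp K ↔ ∀ y ∈ K, y ⬝ᵥ x = 0 := Iff.rfl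

theorem perp_perp {n : ℕ} (K : Submodule F (Fin n → F)) : perp (perp K) = K :=
  LinearMap.BilinForm.orthogonal_orthogonal (dotB_nondeg n) (dotB_refl n) K

theorem finrank_perp {n : ℕ} (K : Submodule F (Fin n → F)) :
    Module.finrank F (perp K) = n - Module.finrank F K := by
  have := LinearMap.BilinForm.finrank_orthogonal (dotB_nondeg n) K
  rw [Module.finrank_fin_fun] at this
  exact this

theorem finrank_le_n {n : ℕ} (K : Submodule F (Fin n → F)) : Module.finrank F K ≤ n := by
  have := Submodule.finrank_le K
  rwa [Module.finrank_fin_fun] at this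

variable {ℓ : ℕ} {m n : Fin ℓ → ℕ}

/-- The trace form. -/
def trB (F : Type*) [Field F] {ℓ : ℕ} (m n : Fin ℓ → ℕ) :
    LinearMap.BilinForm F (∀ i : Fin ℓ, Matrix (Fin (m i)) (Fin (n i)) F) :=
  LinearMap.mk₂ F (fun D C => ∑ i, Matrix.trace (D i * (C i)ᵀ))
    (fun x y z => by simp [Matrix.add_mul, Finset.sum_add_distrib])
    (fun c x y => by simp [Finset.mul_sum])
    (fun x y z => by simp [Matrix.mul_add, Finset.sum_add_distrib])
    (fun c x y => by simp [Finset.mul_sum])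

theorem trB_apply (D C : ∀ i : Fin ℓ, Matrix (Fin (m i)) (Fin (n i)) F) :
    trB F m n D C = ∑ i, Matrix.trace (D i * (C i)ᵀ) := rfl

theorem trB_apply' (D C : ∀ i : Fin ℓ, Matrix (Fin (m i)) (Fin (n i)) F) :
    trB F m n D C = ∑ i, ∑ j, D i j ⬝ᵥ C i j := by
  rw [trB_apply]
  rfl

theorem trB_comm (D C : ∀ i : Fin ℓ, Matrix (Fin (m i)) (Fin (n i)) F) :
    trB F m n D C = trB F m n C D := by
  simp only [trB_apply', dotProduct_comm]

theorem trB_refl : (trB F m n).IsRefl := by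
  intro x y h
  rw [trB_comm, h]

/-- The tuple with a single nonzero row. -/
def oneRow (i : Fin ℓ) (j : Fin (m i)) (x : Fin (n i) → F) :
    ∀ i : Fin ℓ, Matrix (Fin (m i)) (Fin (n i)) F :=
  Pi.single i (Matrix.of (Pi.single j x))

theorem oneRow_self (i : Fin ℓ) (j : Fin (m i)) (x : Fin (n i) → F) :
    (oneRow i j x : ∀ i : Fin ℓ, Matrix (Fin (m i)) (Fin (n i)) F) i j = x := by
  rw [oneRow, Pi.single_eq_same]
  exact Pi.single_eq_same (M := fun _ => Fin (n i) → F) j x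

theorem oneRow_ne (i : Fin ℓ) (j j' : Fin (m i)) (hj : j' ≠ j) (x : Fin (n i) → F) :
    (oneRow i j x : ∀ i : Fin ℓ, Matrix (Fin (m i)) (Fin (n i)) F) i j' = 0 := by
  rw [oneRow, Pi.single_eq_same]
  exact Pi.single_eq_of_ne (M := fun _ => Fin (n i) → F) hj x

theorem trB_oneRow (D : ∀ i : Fin ℓ, Matrix (Fin (m i)) (Fin (n i)) F) (i : Fin ℓ)
    (j : Fin (m i)) (x : Fin (n i) → F) : trB F m n D (oneRow i j x) = D i j ⬝ᵥ x := by
  rw [trB_apply', Finset.sum_eq_single i, Finset.sum_eq_single j]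
  · rw [oneRow_self]
  · intro j' _ hj
    rw [oneRow_ne _ _ _ hj, dotProduct_zero]
  · simp
  · intro i' _ hi
    refine Finset.sum_eq_zero fun j' _ => ?_
    rw [oneRow, Pi.single_eq_of_ne hi]
    exact dotProduct_zero _
  · simp

theorem trB_nondeg : (trB F m n).Nondegenerate := by
  have hr : LinearMap.IsRefl (trB F m n) := trB_refl
  refine hr.nondegenerate_iff_separatingLeft.2 ?_
  intro D hD
  funext i
  ext j k
  have : D i j = 0 := dotProduct_eq_zero _ fun x => by rw [← trB_oneRow, hD]
  rw [this]
  rfl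

theorem dualCode_eq [Fintype F]
    (𝒞 : Submodule F (∀ i : Fin ℓ, Matrix (Fin (m i)) (Fin (n i)) F)) :
    dualCode 𝒞 = (trB F m n).orthogonal 𝒞 := by
  ext D
  change (∀ C ∈ 𝒞, trB F m n D C = 0) ↔ ∀ C ∈ 𝒞, trB F m n C D = 0
  simp only [trB_comm D]

/-- Tuples of matrices whose blocks kill the given subspaces. -/
def killCode (m : Fin ℓ → ℕ) (K : ∀ i, Submodule F (Fin (n i) → F)) :
    Submodule F (∀ i : Fin ℓ, Matrix (Fin (m i)) (Fin (n i)) F) where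
  carrier := {C | ∀ i, K i ≤ LinearMap.ker (C i).mulVecLin}
  add_mem' := by
    intro a b ha hb i x hx
    have h1 := ha i hx
    have h2 := hb i hx
    simp only [LinearMap.mem_ker, Matrix.mulVecLin_apply] at *
    rw [Pi.add_apply, Matrix.add_mulVec, h1, h2, add_zero]
  zero_mem' := by
    intro i x hx
    simp
  smul_mem' := by
    intro r a ha i x hx
    have h1 := ha i hx
    simp only [LinearMap.mem_ker, Matrix.mulVecLin_apply] at *
    rw [Pi.smul_apply, Matrix.smul_mulVec, h1, smul_zero]

theorem mem_killCode {K : ∀ i, Submodule F (Fin (n i) → F)}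
    {C : ∀ i : Fin ℓ, Matrix (Fin (m i)) (Fin (n i)) F} :
    C ∈ killCode m K ↔ ∀ i, K i ≤ LinearMap.ker (C i).mulVecLin := Iff.rfl

theorem mem_killCode' {K : ∀ i, Submodule F (Fin (n i) → F)}
    {C : ∀ i : Fin ℓ, Matrix (Fin (m i)) (Fin (n i)) F} :
    C ∈ killCode m K ↔ ∀ i j, C i j ∈ perp (K i) := by
  rw [mem_killCode]
  refine forall_congr' fun i => ⟨fun h j x hx => ?_, fun h x hx => ?_⟩
  · have := congrFun (LinearMap.mem_ker.1 (h hx)) j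
    rw [Matrix.mulVecLin_apply] at this
    rw [dotB_apply, dotProduct_comm]
    exact this
  · rw [LinearMap.mem_ker, Matrix.mulVecLin_apply]
    funext j
    have := mem_perp.1 (h j) x hx
    rw [dotProduct_comm] at this
    exact this

theorem killCode_perp (K : ∀ i, Submodule F (Fin (n i) → F)) :
    (trB F m n).orthogonal (killCode m K) = killCode m (fun i => perp (K i)) := by
  ext D
  rw [LinearMap.BilinForm.mem_orthogonal_iff, mem_killCode']
  constructor
  · intro h i j
    rw [mem_perp]
    intro x hx
    have hm : oneRow i j x ∈ killCode m K := by
      rw [mem_killCode']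
      intro i' j'
      by_cases hi : i' = i
      · subst hi
        by_cases hj : j' = j
        · subst hj
          rw [oneRow_self]; exact hx
        · rw [oneRow_ne _ _ _ hj]; exact zero_mem _
      · have : (oneRow i j x : ∀ i : Fin ℓ, Matrix (Fin (m i)) (Fin (n i)) F) i' j' = 0 := by
          rw [oneRow, Pi.single_eq_of_ne hi]; rfl
        rw [this]; exact zero_mem _
    have := h _ hm
    rw [trB_comm, trB_oneRow, dotProduct_comm] at this
    exact this
  · intro h C hC
    rw [mem_killCode'] at hC
    rw [trB_apply']
    exact Finset.sum_eq_zero fun i _ => Finset.sum_eq_zero fun j _ => mem_perp.1 (h i j) _ (hC i j)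

theorem finrank_killCode (K : ∀ i, Submodule F (Fin (n i) → F)) :
    Module.finrank F (killCode m K) = ∑ i, m i * (n i - Module.finrank F (K i)) := by
  let e : killCode m K ≃ₗ[F] (∀ i, Fin (m i) → perp (K i)) :=
    { toFun := fun C i j => ⟨C.1 i j, mem_killCode'.1 C.2 i j⟩
      invFun := fun C => ⟨fun i => Matrix.of fun j => (C i j).1,
        mem_killCode'.2 fun i j => (C i j).2⟩
      map_add' := fun _ _ => rfl
      map_smul' := fun _ _ => rfl
      left_inv := fun _ => rfl
      right_inv := fun _ => rfl }
  rw [e.finrank_eq, Module.finrank_pi_fintype]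
  refine Finset.sum_congr rfl fun i _ => ?_
  rw [Module.finrank_pi_fintype]
  simp [finrank_perp]

theorem finrank_all :
    Module.finrank F (∀ i : Fin ℓ, Matrix (Fin (m i)) (Fin (n i)) F) = ∑ i, m i * n i := by
  rw [Module.finrank_pi_fintype]
  simp [Module.finrank_matrix]

theorem finrank_inter [Fintype F]
    (𝒞 : Submodule F (∀ i : Fin ℓ, Matrix (Fin (m i)) (Fin (n i)) F))
    (K : ∀ i, Submodule F (Fin (n i) → F)) :
    Module.finrank F (𝒞 ⊓ killCode m K : Submodule F _) + ∑ i, m i * Module.finrank F (K i) =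
      Module.finrank F 𝒞 +
      Module.finrank F (dualCode 𝒞 ⊓ killCode m (fun i => perp (K i)) : Submodule F _) := by
  have h1 := Submodule.finrank_sup_add_finrank_inf_eq 𝒞 (killCode m K)
  have h2 := LinearMap.BilinForm.finrank_orthogonal (trB_nondeg (F := F) (m := m) (n := n))
    (𝒞 ⊔ killCode m K)
  have h3 : (trB F m n).orthogonal (𝒞 ⊔ killCode m K) =
      dualCode 𝒞 ⊓ killCode m (fun i => perp (K i)) := by
    rw [dualCode_eq, ← killCode_perp]
    apply le_antisymm
    · exact le_inf (LinearMap.BilinForm.orthogonal_le le_sup_left)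
        (LinearMap.BilinForm.orthogonal_le le_sup_right)
    · rintro D ⟨hD1, hD2⟩ C hC
      obtain ⟨a, ha, b, hb, rfl⟩ := Submodule.mem_sup.1 hC
      have e1 : trB F m n a D = 0 := hD1 a ha
      have e2 : trB F m n b D = 0 := hD2 b hb
      rw [map_add, LinearMap.add_apply, e1, e2, add_zero]
  have h4 := Submodule.finrank_le (𝒞 ⊔ killCode m K)
  have h5 : ∑ i, m i * (n i - Module.finrank F (K i)) + ∑ i, m i * Module.finrank F (K i) =
      ∑ i, m i * n i := by
    rw [← Finset.sum_add_distrib]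
    refine Finset.sum_congr rfl fun i _ => ?_
    rw [← mul_add, Nat.sub_add_cancel (finrank_le_n _)]
  rw [h3] at h2
  rw [finrank_killCode] at h1
  rw [finrank_all] at h2 h4
  omega

end Duality

/-! ### Double counting -/

section Assembly

variable {F : Type*} [Field F] [Fintype F] {ℓ : ℕ} {m n : Fin ℓ → ℕ}

theorem finsum_Wlist [Fintype (∀ i : Fin ℓ, Matrix (Fin (m i)) (Fin (n i)) F)]
    (𝒞 : Submodule F (∀ i : Fin ℓ, Matrix (Fin (m i)) (Fin (n i)) F)) [Fintype 𝒞]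
    (f : (Fin ℓ → ℕ) → ℚ) :
    ∑ᶠ u : Fin ℓ → ℕ, (Wlist 𝒞 u : ℚ) * f u = ∑ C : 𝒞, f (fun i => (C.1 i).rank) := by
  classical
  have hW : ∀ u, Wlist 𝒞 u =
      (Finset.univ.filter (fun C : 𝒞 => (fun i => (C.1 i).rank) = u)).card := by
    intro u
    rw [← Fintype.card_subtype, ← Nat.card_eq_fintype_card]
    refine Nat.card_congr
      { toFun := fun C => ⟨⟨C.1, C.2.1⟩, funext C.2.2⟩
        invFun := fun C => ⟨C.1.1, C.1.2, fun i => congrFun C.2 i⟩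
        left_inv := fun _ => rfl
        right_inv := fun _ => rfl }
  rw [Finset.sum_comp f (fun C : 𝒞 => fun i => (C.1 i).rank),
    finsum_eq_sum_of_support_subset (s := Finset.univ.image (fun C : 𝒞 => fun i => (C.1 i).rank))]
  · refine Finset.sum_congr rfl fun u _ => ?_
    rw [hW, nsmul_eq_mul]
  · intro u hu
    rw [Function.mem_support, hW] at hu
    have h0 : (Finset.univ.filter (fun C : 𝒞 => (fun i => (C.1 i).rank) = u)).Nonempty := by
      rw [← Finset.card_pos, Nat.pos_iff_ne_zero]
      intro h
      rw [h] at hu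
      simp at hu
    obtain ⟨C, hC⟩ := h0
    rw [Finset.mem_coe, Finset.mem_image]
    exact ⟨C, Finset.mem_univ _, (Finset.mem_filter.1 hC).2⟩

/-- Tuples of subspaces with prescribed dimensions. -/
def SubTuple (F : Type*) [Field F] (n k : Fin ℓ → ℕ) : Type _ :=
  {K : ∀ i, Submodule F (Fin (n i) → F) // ∀ i, Module.finrank F (K i) = k i}

instance (k : Fin ℓ → ℕ) : Finite (SubTuple F n k) :=
  inferInstanceAs (Finite {K : ∀ i, Submodule F (Fin (n i) → F) // ∀ i, Module.finrank F (K i) = k i})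

theorem finrank_ker_mulVecLin {a b : ℕ} (M : Matrix (Fin a) (Fin b) F) :
    Module.finrank F (LinearMap.ker M.mulVecLin) = b - M.rank := by
  have := LinearMap.finrank_range_add_finrank_ker M.mulVecLin
  rw [Module.finrank_fin_fun] at this
  rw [Matrix.rank]
  omega

theorem prod_gauss (k : Fin ℓ → ℕ) (C : ∀ i : Fin ℓ, Matrix (Fin (m i)) (Fin (n i)) F) :
    ∏ i, gauss (Fintype.card F) ((n i - (C i).rank : ℕ) : ℤ) (k i : ℤ) =
      (Nat.card {K : SubTuple F n k // C ∈ killCode m K.1} : ℚ) := by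
  have h : ∀ i, gauss (Fintype.card F) ((n i - (C i).rank : ℕ) : ℤ) (k i : ℤ) =
      (Nat.card {U : Submodule F (Fin (n i) → F) // U ≤ LinearMap.ker (C i).mulVecLin ∧
        Module.finrank F U = k i} : ℚ) := by
    intro i
    rw [card_sub, finrank_ker_mulVecLin]
  rw [Finset.prod_congr rfl fun i _ => h i, ← Nat.cast_prod, ← Nat.card_pi]
  congr 1
  exact Nat.card_congr
    { toFun := fun K => ⟨⟨fun i => (K i).1, fun i => (K i).2.2⟩, fun i => (K i).2.1⟩
      invFun := fun K i => ⟨K.1.1 i, K.2 i, K.1.2 i⟩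
      left_inv := fun _ => rfl
      right_inv := fun _ => rfl }

theorem moment (k : Fin ℓ → ℕ) [Fintype (SubTuple F n k)]
    (𝒞 : Submodule F (∀ i : Fin ℓ, Matrix (Fin (m i)) (Fin (n i)) F)) [Fintype 𝒞] :
    ∑ C : 𝒞, ∏ i, gauss (Fintype.card F) ((n i - (C.1 i).rank : ℕ) : ℤ) (k i : ℤ) =
      ∑ K : SubTuple F n k, (Nat.card (𝒞 ⊓ killCode m K.1 : Submodule F _) : ℚ) := by
  simp only [prod_gauss]
  rw [← Nat.cast_sum, ← Nat.cast_sum, ← Nat.card_sigma, ← Nat.card_sigma]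
  congr 1
  exact Nat.card_congr
    { toFun := fun x => ⟨x.2.1, ⟨x.1.1, x.1.2, x.2.2⟩⟩
      invFun := fun x => ⟨⟨x.2.1, x.2.2.1⟩, ⟨x.1, x.2.2.2⟩⟩
      left_inv := fun _ => rfl
      right_inv := fun _ => rfl }

/-- Orthogonality as a bijection on tuples of subspaces. -/
def perpEquiv (v : Fin ℓ → ℕ) (hv : ∀ i, v i ≤ n i) :
    SubTuple F n (fun i => n i - v i) ≃ SubTuple F n v where
  toFun K := ⟨fun i => perp (K.1 i), fun i => by
    have := hv i
    rw [finrank_perp, K.2 i]; exact Nat.sub_sub_self this⟩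
  invFun K := ⟨fun i => perp (K.1 i), fun i => by rw [finrank_perp, K.2 i]⟩
  left_inv K := Subtype.ext (funext fun i => perp_perp _)
  right_inv K := Subtype.ext (funext fun i => perp_perp _)

end Assembly

/-- **Binomial moments** of the rank-list distribution of a sum-rank metric code. -/
theorem binomial_moments_rank_list {F : Type*} [Field F] [Fintype F] {ℓ : ℕ}
    (m n : Fin ℓ → ℕ) (hℓ : 0 < ℓ) (hm : ∀ i j : Fin ℓ, i ≤ j → m j ≤ m i)
    (hmpos : ∀ i, 0 < m i) (hnm : ∀ i, n i ≤ m i) (hnpos : ∀ i, 0 < n i)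
    (𝒞 : Submodule F (∀ i : Fin ℓ, Matrix (Fin (m i)) (Fin (n i)) F))
    (v : Fin ℓ → ℕ) :
    (∑ᶠ u : Fin ℓ → ℕ, (Wlist 𝒞 u : ℚ) *
        ∏ i, gauss (Fintype.card F) ((n i : ℤ) - (u i : ℤ)) ((v i : ℤ) - (u i : ℤ))) =
      ((Nat.card 𝒞 : ℚ) /
          (Fintype.card F : ℚ) ^ (∑ i, (m i : ℤ) * ((n i : ℤ) - (v i : ℤ)))) *
        ∑ᶠ u : Fin ℓ → ℕ, (Wlist (dualCode 𝒞) u : ℚ) *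
          ∏ i, gauss (Fintype.card F) ((n i : ℤ) - (u i : ℤ)) (v i : ℤ) := by
  classical
  have hq : (1 : ℚ) < Fintype.card F := by exact_mod_cast Fintype.one_lt_card
  have hq0 : (Fintype.card F : ℚ) ≠ 0 := by linarith
  by_cases hv : ∀ i, v i ≤ n i
  swap
  · push Not at hv
    obtain ⟨i, hi⟩ := hv
    have h1 : ∀ u : Fin ℓ → ℕ, ∏ i, gauss (Fintype.card F) ((n i : ℤ) - (u i : ℤ))
        ((v i : ℤ) - (u i : ℤ)) = 0 := fun u =>
      Finset.prod_eq_zero (Finset.mem_univ i) (gauss_zero_of_lt _ _ _ (by omega))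
    have h2 : ∀ u : Fin ℓ → ℕ, ∏ i, gauss (Fintype.card F) ((n i : ℤ) - (u i : ℤ))
        (v i : ℤ) = 0 := fun u =>
      Finset.prod_eq_zero (Finset.mem_univ i) (gauss_zero_of_lt _ _ _ (by omega))
    simp only [h1, h2, mul_zero, finsum_zero]
  have : Fintype (∀ i : Fin ℓ, Matrix (Fin (m i)) (Fin (n i)) F) := Fintype.ofFinite _
  have : Fintype 𝒞 := Fintype.ofFinite _
  have : Fintype (dualCode 𝒞) := Fintype.ofFinite _
  have : Fintype (SubTuple F n v) := Fintype.ofFinite _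
  have : Fintype (SubTuple F n (fun i => n i - v i)) := Fintype.ofFinite _
  have hrk : ∀ (C : ∀ i : Fin ℓ, Matrix (Fin (m i)) (Fin (n i)) F) (i : Fin ℓ),
      (C i).rank ≤ n i := fun C i => Matrix.rank_le_width (C i)
  rw [finsum_Wlist 𝒞 (fun u => ∏ i, gauss (Fintype.card F) ((n i : ℤ) - (u i : ℤ))
      ((v i : ℤ) - (u i : ℤ))),
    finsum_Wlist (dualCode 𝒞) (fun u => ∏ i, gauss (Fintype.card F) ((n i : ℤ) - (u i : ℤ))
      (v i : ℤ))]
  have hL : ∀ C : 𝒞, ∏ i, gauss (Fintype.card F) ((n i : ℤ) - ((C.1 i).rank : ℤ))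
      ((v i : ℤ) - ((C.1 i).rank : ℤ)) = ∏ i, gauss (Fintype.card F)
      ((n i - (C.1 i).rank : ℕ) : ℤ) ((n i - v i : ℕ) : ℤ) := fun C =>
    Finset.prod_congr rfl fun i _ => gauss_symm hq _ _ _ (hrk C.1 i) (hv i)
  have hR : ∀ C : dualCode 𝒞, ∏ i, gauss (Fintype.card F) ((n i : ℤ) - ((C.1 i).rank : ℤ))
      (v i : ℤ) = ∏ i, gauss (Fintype.card F)
      ((n i - (C.1 i).rank : ℕ) : ℤ) (v i : ℤ) := fun C =>
    Finset.prod_congr rfl fun i _ => by rw [Nat.cast_sub (hrk C.1 i)]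
  rw [Finset.sum_congr rfl fun C _ => hL C, Finset.sum_congr rfl fun C _ => hR C,
    moment v (dualCode 𝒞), moment (fun i => n i - v i) 𝒞, Finset.mul_sum]
  refine Fintype.sum_equiv (perpEquiv v hv) _ _ fun K => ?_
  have hfin := finrank_inter 𝒞 K.1
  have hexp : (∑ i, (m i : ℤ) * ((n i : ℤ) - (v i : ℤ))) =
      ((∑ i, m i * Module.finrank F (K.1 i) : ℕ) : ℤ) := by
    push_cast
    refine Finset.sum_congr rfl fun i _ => ?_
    rw [K.2 i, Nat.cast_sub (hv i)]
  have hpe : (perpEquiv v hv K).1 = fun i => perp (K.1 i) := rfl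
  rw [hexp, zpow_natCast, hpe, Module.natCard_eq_pow_finrank (K := F) (V := 𝒞),
    Module.natCard_eq_pow_finrank (K := F) (V := (𝒞 ⊓ killCode m K.1 : Submodule F _)),
    Module.natCard_eq_pow_finrank (K := F)
      (V := (dualCode 𝒞 ⊓ killCode m (fun i => perp (K.1 i)) : Submodule F _)),
    Nat.card_eq_fintype_card (α := F)]
  rw [div_mul_eq_mul_div, eq_div_iff (pow_ne_zero _ hq0)]
  push_cast
  rw [← pow_add, ← pow_add, hfin]
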